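/- arXiv:1710.08971 — 2 statements merged into one kernel-verified Lean document; each statement's English description precedes it below -/
import Mathlib

section
/- Let Σ be an S-sorted signature, 𝐀 = (A, F) a Σ-algebra, and n ∈ ℕ. If Σ_{w,s} = ∅ whenever |w| > n (i.e., every operation of 𝐀 is of arity ≤ n), then the many-sorted closure operator Sg_𝐀 on A is n-ary, i.e., Sg_𝐀 = (Sg_𝐀)_{≤n}^ω. -/
universe u v w

namespace ManySorted

variable {S : Type u}

/-- The delta of Kronecker `δ^{t,x}`: the S-sorted set whose `t`-th coordinate is `{x}`
and whose other coordinates are empty. -/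
def delta {α : S → Type v} (t : S) (x : α t) : ∀ s, Set (α s) :=
  fun s => {y | (⟨s, y⟩ : Σ s, α s) = ⟨t, x⟩}

/-- The cardinal of an S-sorted set: the cardinal of its coproduct. -/
def scard {α : S → Type v} (X : ∀ s, Set (α s)) : Cardinal.{max u v} :=
  Cardinal.mk (Σ s, ↥(X s))

/-- The support of an S-sorted set. -/
def supp {α : S → Type v} (X : ∀ s, Set (α s)) : Set S := {s | (X s).Nonempty}

section Closure

variable {α : S → Type v}

/-- `J` is a many-sorted closure operator: extensive, isotone and idempotent. -/
def IsClosureOp (J : (∀ s, Set (α s)) → (∀ s, Set (α s))) : Prop :=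
  (∀ X s, X s ⊆ J X s) ∧
  (∀ X Y, (∀ s, X s ⊆ Y s) → ∀ s, J X s ⊆ J Y s) ∧
  (∀ X, J (J X) = J X)

/-- The operator `J_{≤n}`. -/
def Jle (J : (∀ s, Set (α s)) → (∀ s, Set (α s))) (n : ℕ)
    (X : ∀ s, Set (α s)) : ∀ s, Set (α s) :=
  fun s => ⋃ (Y : ∀ s, Set (α s)) (_ : (∀ t, Y t ⊆ X t) ∧ scard Y ≤ (n : Cardinal)), J Y s

/-- The iterates `J_{≤n}^m`. -/
def JleIter (J : (∀ s, Set (α s)) → (∀ s, Set (α s))) (n : ℕ) :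
    ℕ → (∀ s, Set (α s)) → (∀ s, Set (α s))
  | 0 => fun X => X
  | k + 1 => fun X => Jle J n (JleIter J n k X)

/-- The operator `J_{≤n}^ω`. -/
def Jlomega (J : (∀ s, Set (α s)) → (∀ s, Set (α s))) (n : ℕ)
    (X : ∀ s, Set (α s)) : ∀ s, Set (α s) :=
  fun s => ⋃ m : ℕ, JleIter J n m X s

/-- `J` is an `n`-ary many-sorted closure operator if `J = J_{≤n}^ω`. -/
def IsNary (n : ℕ) (J : (∀ s, Set (α s)) → (∀ s, Set (α s))) : Prop :=
  J = Jlomega J n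

/-- `J` is algebraic. -/
def Algebraic (J : (∀ s, Set (α s)) → (∀ s, Set (α s))) : Prop :=
  ∀ X, J X = fun s =>
    ⋃ (K : ∀ s, Set (α s)) (_ : (∀ t, K t ⊆ X t) ∧ scard K < Cardinal.aleph0), J K s

/-- `J` is uniform. -/
def Uniform (J : (∀ s, Set (α s)) → (∀ s, Set (α s))) : Prop :=
  ∀ X Y, supp X = supp Y → supp (J X) = supp (J Y)

/-- `X` is irredundant (independent) with respect to `J`. -/
def Irredundant (J : (∀ s, Set (α s)) → (∀ s, Set (α s)))
    (X : ∀ s, Set (α s)) : Prop :=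
  ∀ s, ∀ x ∈ X s, x ∉ J (fun t => X t \ delta s x t) s

/-- `X` is a basis (generator) with respect to `J`. -/
def IsBasis (J : (∀ s, Set (α s)) → (∀ s, Set (α s)))
    (X : ∀ s, Set (α s)) : Prop :=
  ∀ s, J X s = Set.univ

/-- `IrB (A, J)`: the set of natural numbers that are the cardinal of an irredundant basis. -/
def IrB (J : (∀ s, Set (α s)) → (∀ s, Set (α s))) : Set ℕ :=
  {n | ∃ X : ∀ s, Set (α s), Irredundant J X ∧ IsBasis J X ∧ scard X = (n : Cardinal)}

end Closure

section Algebra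

variable {α : S → Type v}

/-- `X` is closed under all the operations of the algebra `(A, F)`. -/
def Closed (Sig : List S → S → Type w)
    (F : ∀ w s, Sig w s → ((∀ i : Fin w.length, α (w.get i)) → α s))
    (X : ∀ s, Set (α s)) : Prop :=
  ∀ (w : List S) (s : S) (σ : Sig w s) (a : ∀ i : Fin w.length, α (w.get i)),
    (∀ i, a i ∈ X (w.get i)) → F w s σ a ∈ X s

/-- The subalgebra generating operator `Sg`. -/
def Sg (Sig : List S → S → Type w)
    (F : ∀ w s, Sig w s → ((∀ i : Fin w.length, α (w.get i)) → α s))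
    (X : ∀ s, Set (α s)) : ∀ s, Set (α s) :=
  fun s => ⋂ (C : ∀ s, Set (α s)) (_ : Closed Sig F C ∧ ∀ t, X t ⊆ C t), C s

/-- The one-step operator `E_𝐀`. -/
def Estep (Sig : List S → S → Type w)
    (F : ∀ w s, Sig w s → ((∀ i : Fin w.length, α (w.get i)) → α s))
    (X : ∀ s, Set (α s)) : ∀ s, Set (α s) :=
  fun s => X s ∪ {y | ∃ (w : List S) (σ : Sig w s) (a : ∀ i : Fin w.length, α (w.get i)),
    (∀ i, a i ∈ X (w.get i)) ∧ F w s σ a = y}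

/-- The iterates `E_𝐀^n`. -/
def Eiter (Sig : List S → S → Type w)
    (F : ∀ w s, Sig w s → ((∀ i : Fin w.length, α (w.get i)) → α s)) :
    ℕ → (∀ s, Set (α s)) → (∀ s, Set (α s))
  | 0 => fun X => X
  | k + 1 => fun X => Estep Sig F (Eiter Sig F k X)

/-- `E_𝐀^ω`. -/
def Eomega (Sig : List S → S → Type w)
    (F : ∀ w s, Sig w s → ((∀ i : Fin w.length, α (w.get i)) → α s))
    (X : ∀ s, Set (α s)) : ∀ s, Set (α s) :=
  fun s => ⋃ n : ℕ, Eiter Sig F n X s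

end Algebra

end ManySorted

namespace ManySorted

variable {S : Type u} {α : S → Type v} {J : (∀ s, Set (α s)) → (∀ s, Set (α s))}

theorem mem_Jle {n : ℕ} {X : ∀ s, Set (α s)} {s : S} {x : α s} :
    x ∈ Jle J n X s ↔
      ∃ Y : ∀ s, Set (α s), ((∀ t, Y t ⊆ X t) ∧ scard Y ≤ (n : Cardinal)) ∧ x ∈ J Y s := by
  simp only [Jle, Set.mem_iUnion, exists_prop]

/-- The S-sorted set of entries of a tuple. -/
def entries {ι : Type} {f : ι → S} (a : ∀ i, α (f i)) : ∀ s, Set (α s) :=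
  fun s => {y | ∃ i, (⟨f i, a i⟩ : Σ s, α s) = ⟨s, y⟩}

theorem mem_entries {ι : Type} {f : ι → S} (a : ∀ i, α (f i)) (i : ι) :
    a i ∈ entries a (f i) :=
  ⟨i, rfl⟩

theorem entries_subset {ι : Type} {f : ι → S} {a : ∀ i, α (f i)} {X : ∀ s, Set (α s)}
    (h : ∀ i, a i ∈ X (f i)) (t : S) : entries a t ⊆ X t := by
  rintro y ⟨i, hi⟩
  cases hi
  exact h i

theorem scard_entries_le {k : ℕ} {f : Fin k → S} (a : ∀ i, α (f i)) :
    scard (entries a) ≤ (k : Cardinal) := by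
  have hsurj : Function.Surjective
      (fun i => ⟨f i, a i, mem_entries a i⟩ : Fin k → Σ s, ↥(entries a s)) := by
    rintro ⟨s, y, i, hi⟩
    cases hi
    exact ⟨i, rfl⟩
  simpa [scard] using Cardinal.mk_le_of_surjective
    (hsurj.comp (Equiv.ulift.{max u v}).surjective)

/-- The value of `J` at the entries of a tuple of length at most `n` lies in `J_{≤n}`. -/
theorem entries_subset_Jle {n k : ℕ} (hk : k ≤ n) {f : Fin k → S} {a : ∀ i, α (f i)}
    {X : ∀ s, Set (α s)} (h : ∀ i, a i ∈ X (f i)) (s : S) : J (entries a) s ⊆ Jle J n X s :=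
  fun _ hx => mem_Jle.2
    ⟨entries a, ⟨entries_subset h, (scard_entries_le a).trans (by exact_mod_cast hk)⟩, hx⟩

theorem subset_Jle (hJ : ∀ X s, X s ⊆ J X s) {n : ℕ} (hn : 1 ≤ n) (X : ∀ s, Set (α s)) (s : S) :
    X s ⊆ Jle J n X s := fun x hx =>
  entries_subset_Jle (f := fun _ : Fin 1 => s) (a := fun _ => x) hn (fun _ => hx) s
    (hJ _ _ (mem_entries (f := fun _ : Fin 1 => s) (fun _ => x) 0))

theorem JleIter_mono (hJ : ∀ X s, X s ⊆ J X s) {n : ℕ} (hn : 1 ≤ n) (X : ∀ s, Set (α s)) (s : S) :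
    Monotone fun m => JleIter J n m X s :=
  monotone_nat_of_le_succ fun _ => subset_Jle hJ hn _ s

theorem Jlomega_subset (hJ : IsClosureOp J) (n : ℕ) (X : ∀ s, Set (α s)) (s : S) :
    Jlomega J n X s ⊆ J X s := by
  refine Set.iUnion_subset fun m => ?_
  induction m generalizing s with
  | zero => exact hJ.1 X s
  | succ m ih =>
    intro x hx
    obtain ⟨Y, ⟨hY, -⟩, hxY⟩ := mem_Jle.1 hx
    rw [← hJ.2.2 X]
    exact hJ.2.1 _ _ (fun t => (hY t).trans (ih t)) s hxY

section Algebra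

variable {Sig : List S → S → Type w}
  {F : ∀ w s, Sig w s → ((∀ i : Fin w.length, α (w.get i)) → α s)}

theorem subset_Sg (X : ∀ s, Set (α s)) (s : S) : X s ⊆ Sg Sig F X s :=
  Set.subset_iInter₂ fun _ hC => hC.2 s

theorem Sg_subset {X C : ∀ s, Set (α s)} (hC : Closed Sig F C) (hX : ∀ t, X t ⊆ C t) (s : S) :
    Sg Sig F X s ⊆ C s :=
  Set.iInter₂_subset C ⟨hC, hX⟩

theorem closed_Sg (X : ∀ s, Set (α s)) : Closed Sig F (Sg Sig F X) :=
  fun w s σ a ha => Set.mem_iInter₂.2 fun _ hC =>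
    hC.1 w s σ a fun i => Sg_subset hC.1 hC.2 _ (ha i)

theorem isClosureOp_Sg : IsClosureOp (Sg Sig F) :=
  ⟨subset_Sg, fun _ Y h => Sg_subset (closed_Sg Y) fun t => (h t).trans (subset_Sg Y t),
    fun X => funext fun s =>
      (Sg_subset (closed_Sg X) (fun _ => subset_rfl) s).antisymm (subset_Sg _ s)⟩

theorem closed_Jlomega_Sg {n : ℕ}
    (harity : ∀ (w : List S) (s : S), n < w.length → IsEmpty (Sig w s)) (X : ∀ s, Set (α s)) :
    Closed Sig F (Jlomega (Sg Sig F) n X) := by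
  intro w s σ a ha
  have hw : w.length ≤ n := not_lt.1 fun h => (harity w s h).false σ
  choose m hm using fun i => Set.mem_iUnion.1 (ha i)
  -- If `n = 0` the iterates need not increase, but then the tuple `a` is empty.
  have hM : ∀ i, a i ∈ JleIter (Sg Sig F) n (Finset.univ.sup m) X (w.get i) := fun i =>
    JleIter_mono subset_Sg (i.pos.trans_le hw) X _ (Finset.le_sup (Finset.mem_univ i)) (hm i)
  exact Set.mem_iUnion.2 ⟨Finset.univ.sup m + 1, entries_subset_Jle hw hM s
    (closed_Sg _ w s σ a fun i => subset_Sg _ _ (mem_entries a i))⟩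

end Algebra

end ManySorted

open ManySorted in
/-- If every operation of `𝐀` is of arity `≤ n`, then `Sg_𝐀` is `n`-ary. -/
theorem statement_15 {S : Type u} {α : S → Type v}
    (Sig : List S → S → Type w)
    (F : ∀ w s, Sig w s → ((∀ i : Fin w.length, α (w.get i)) → α s))
    (n : ℕ) (harity : ∀ (w : List S) (s : S), n < w.length → IsEmpty (Sig w s)) :
    IsNary n (Sg Sig F) := by
  exact funext fun X => funext fun s =>
    (Sg_subset (closed_Jlomega_Sg harity X)
      (fun t => Set.subset_iUnion (fun m => JleIter (Sg Sig F) n m X t) 0) s).antisymm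
      (Jlomega_subset isClosureOp_Sg n X s)
end

section
/- Let A be an S-sorted set, J a many-sorted closure operator on A, and n ∈ ℕ. If J is n-ary and uniform, then there exist an S-sorted signature Σ' and a Σ'-algebra 𝐀' with underlying S-sorted set A such that J = Sg_{𝐀'} and every operation of 𝐀' is of arity ≤ n (i.e., Σ'_{w,s} = ∅ whenever |w| > n). -/
universe u v w

namespace ManySorted

/-- The S-sorted set of the values of a tuple. -/
def tupleRange {S : Type u} {α : S → Type v} {w : List S}
    (a : ∀ i : Fin w.length, α (w.get i)) : ∀ s, Set (α s) :=
  fun s => {x | ∃ i, (⟨w.get i, a i⟩ : Σ s, α s) = ⟨s, x⟩}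

theorem tupleRange_subset {S : Type u} {α : S → Type v} {w : List S}
    {a : ∀ i : Fin w.length, α (w.get i)} {X : ∀ s, Set (α s)}
    (h : ∀ i, a i ∈ X (w.get i)) (s : S) : tupleRange a s ⊆ X s := by
  rintro x ⟨i, hi⟩
  have : ∀ p q : Σ s, α s, p = q → p.2 ∈ X p.1 → q.2 ∈ X q.1 := by
    rintro p _ rfl hp
    exact hp
  exact this _ _ hi (h i)

theorem supp_tupleRange {S : Type u} {α : S → Type v} {w : List S}
    (a : ∀ i : Fin w.length, α (w.get i)) : supp (tupleRange a) = {s | s ∈ w} := by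
  ext s
  constructor
  · rintro ⟨x, i, hi⟩
    have : w.get i = s := congrArg Sigma.fst hi
    exact this ▸ List.get_mem w i
  · intro hs
    obtain ⟨i, rfl⟩ := List.get_of_mem hs
    exact ⟨a i, i, rfl⟩

/-- Every S-sorted set of cardinal at most `n` is the set of values of a tuple of length at
most `n`. -/
theorem exists_tupleRange_eq {S : Type u} {α : S → Type v} {n : ℕ} {Y : ∀ s, Set (α s)}
    (hY : scard Y ≤ (n : Cardinal)) :
    ∃ (w : List S) (a : ∀ i : Fin w.length, α (w.get i)), w.length ≤ n ∧ tupleRange a = Y := by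
  have hfin : Finite (Σ s, ↥(Y s)) :=
    Cardinal.lt_aleph0_iff_finite.1 (hY.trans_lt Cardinal.natCast_lt_aleph0)
  have := Fintype.ofFinite (Σ s, ↥(Y s))
  let l : List (Σ s, ↥(Y s)) := Finset.univ.toList
  have hl : l.length ≤ n := by
    rw [scard, Cardinal.mk_fintype] at hY
    simpa [l] using hY
  have hex : ∀ i : Fin (l.map Sigma.fst).length, ∃ x : α ((l.map Sigma.fst).get i),
      (⟨(l.map Sigma.fst).get i, x⟩ : Σ s, α s) =
        ⟨(l.get (i.cast (l.length_map _))).1, (l.get (i.cast (l.length_map _))).2⟩ := by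
    intro i
    have h : (l.map Sigma.fst).get i = (l.get (i.cast (l.length_map _))).1 := by simp
    rw [h]
    exact ⟨_, rfl⟩
  choose a ha using hex
  refine ⟨l.map Sigma.fst, a, by simpa using hl, ?_⟩
  ext s x
  constructor
  · rintro ⟨i, hi⟩
    rw [ha] at hi
    generalize l.get (i.cast (l.length_map _)) = p at hi
    obtain ⟨t, y, hy⟩ := p
    cases hi
    exact hy
  · intro hx
    obtain ⟨i, hi⟩ := List.get_of_mem (Finset.mem_toList.2
      (Finset.mem_univ (⟨s, x, hx⟩ : Σ s, ↥(Y s))))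
    refine ⟨i.cast (l.length_map _).symm, ?_⟩
    rw [ha]
    change (⟨(l.get i).1, (l.get i).2⟩ : Σ s, α s) = _
    rw [hi]

/-- For a uniform `J`, each element of `J` of the range of a tuple `a` is the value at `a` of an
operation whose values all lie in `J` of the range of their arguments. -/
theorem Uniform.exists_operation {S : Type u} {α : S → Type v}
    {J : (∀ s, Set (α s)) → (∀ s, Set (α s))} (huni : Uniform J) {w : List S} {s : S}
    (a : ∀ i : Fin w.length, α (w.get i)) {y : α s} (hy : y ∈ J (tupleRange a) s) :
    ∃ f : (∀ i : Fin w.length, α (w.get i)) → α s,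
      (∀ b, f b ∈ J (tupleRange b) s) ∧ f a = y := by
  classical
  have hne : ∀ b : ∀ i : Fin w.length, α (w.get i), (J (tupleRange b) s).Nonempty := by
    intro b
    have h := huni (tupleRange a) (tupleRange b) (by rw [supp_tupleRange, supp_tupleRange])
    have hs : s ∈ supp (J (tupleRange a)) := ⟨y, hy⟩
    rwa [h] at hs
  choose g hg using hne
  refine ⟨Function.update g a y, fun b => ?_, Function.update_self ..⟩
  by_cases hb : b = a
  · subst hb
    rwa [Function.update_self]
  · rw [Function.update_of_ne hb]
    exact hg b

end ManySorted

open ManySorted in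
/-- If `J` is `n`-ary and uniform, then `J = Sg_𝐀'` for some signature `Σ'` and
`Σ'`-algebra `𝐀'` on `A` all of whose operations are of arity `≤ n`. -/
theorem statement_16 {S : Type u} {α : S → Type v}
    (J : (∀ s, Set (α s)) → (∀ s, Set (α s))) (hJ : IsClosureOp J) (n : ℕ)
    (hnary : IsNary n J) (huni : Uniform J) :
    ∃ (Sig : List S → S → Type (max u v))
      (F : ∀ w s, Sig w s → ((∀ i : Fin w.length, α (w.get i)) → α s)),
      J = Sg Sig F ∧ ∀ (w : List S) (s : S), n < w.length → IsEmpty (Sig w s) := by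
  obtain ⟨hext, hmono, hidem⟩ := hJ
  refine ⟨fun w s => ULift.{max u v} {f : (∀ i : Fin w.length, α (w.get i)) → α s //
    w.length ≤ n ∧ ∀ b, f b ∈ J (tupleRange b) s}, fun w s σ => σ.down.1, ?_,
    fun w s hw => ⟨fun σ => absurd σ.down.2.1 (not_le.2 hw)⟩⟩
  funext X s
  apply Set.Subset.antisymm
  · refine Set.subset_iInter₂ fun C hC => ?_
    obtain ⟨hclosed, hXC⟩ := hC
    have hiter : ∀ m t, JleIter J n m X t ⊆ C t := by
      intro m
      induction m with
      | zero => exact hXC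
      | succ k ih =>
        intro t
        refine Set.iUnion₂_subset fun Y hY y hy => ?_
        obtain ⟨w, a, hw, rfl⟩ := exists_tupleRange_eq hY.2
        obtain ⟨f, hf, rfl⟩ := huni.exists_operation a hy
        exact hclosed w t ⟨f, hw, hf⟩ a fun i => ih _ (hY.1 _ ⟨i, rfl⟩)
    rw [hnary]
    exact Set.iUnion_subset fun m => hiter m s
  · refine Set.iInter₂_subset (J X) ⟨?_, hext X⟩
    intro w t σ a ha
    rw [← hidem X]
    exact hmono _ _ (tupleRange_subset ha) t (σ.down.2.2 a)
end
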